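/- Multiplier identity, far version (Lemma 8.3, identity (8.2), radial form): let γ : (0,∞) → ℝ be smooth and κ ∈ ℝ. For every test function v, −Re ∫ ((ρ²+κ²) v + Δ_rad v) · conj(v) · γ dμ_d = ∫ γ ( |v′ + (ρ − iκ) v|² + 2ρ² (coth(r) − 1) |v|² ) dμ_d + 2κ Re ∫ i v · conj( γ (v′ + (ρ − iκ) v) ) dμ_d − ∫ ( (1/2) γ″ + ρ (coth(r) − 1) γ′ ) |v|² dμ_d. -/

import Mathlib

open MeasureTheory Set

/-- A radial test function: a smooth function on `ℝ` with compact support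
contained in `(0, ∞)`. -/
def IsTestFun (v : ℝ → ℂ) : Prop :=
  ContDiff ℝ (⊤ : ℕ∞) v ∧ HasCompactSupport v ∧ tsupport v ⊆ Set.Ioi (0 : ℝ)

/-- The hyperbolic cotangent. -/
noncomputable def cothR (r : ℝ) : ℝ := Real.cosh r / Real.sinh r

/-- `ρ = (d-1)/2`. -/
noncomputable def rho (d : ℕ) : ℝ := ((d : ℝ) - 1) / 2

/-- The radial part of the Laplace–Beltrami operator of hyperbolic space:
`Δ_rad f = f″ + (d−1) coth(r) f′`. -/
noncomputable def DradC (d : ℕ) (v : ℝ → ℂ) (r : ℝ) : ℂ :=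
  deriv (deriv v) r + ((((d : ℝ) - 1) * cothR r : ℝ) : ℂ) * deriv v r

/-- A function continuous on `(0, ∞)` and vanishing off a compact subset of `(0, ∞)` is integrable. -/
theorem integrableOn_Ioi_of_continuousOn_of_compact {E : Type*} [NormedAddCommGroup E]
    {f : ℝ → E} {K : Set ℝ} (hK : IsCompact K) (hK0 : K ⊆ Ioi (0 : ℝ))
    (hf : ContinuousOn f (Ioi (0 : ℝ))) (h0 : ∀ r ∉ K, f r = 0) :
    IntegrableOn f (Ioi (0 : ℝ)) :=
  ((hf.mono hK0).integrableOn_compact hK).of_forall_sdiff_eq_zero measurableSet_Ioi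
    fun r hr => h0 r hr.2

/-- The integral over `(0, ∞)` of the derivative of a function supported in a compact subset of
`(0, ∞)` vanishes. -/
theorem integral_Ioi_eq_zero_of_hasDerivAt_of_compact {F G : ℝ → ℝ} {K : Set ℝ}
    (hK : IsCompact K) (hK0 : K ⊆ Ioi (0 : ℝ)) (hF : ∀ r ∈ Ioi (0 : ℝ), HasDerivAt F (G r) r)
    (hG : IntegrableOn G (Ioi (0 : ℝ))) (h0 : ∀ r ∉ K, F r = 0) :
    ∫ r in Ioi (0 : ℝ), G r = 0 := by
  have h0K : (0 : ℝ) ∉ K := fun h => lt_irrefl (0 : ℝ) (hK0 h)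
  have hnhds : F =ᶠ[nhds 0] fun _ => (0 : ℝ) := by
    filter_upwards [hK.isClosed.isOpen_compl.mem_nhds h0K] with r hr using h0 r hr
  have htop : Filter.Tendsto F Filter.atTop (nhds 0) := by
    refine tendsto_const_nhds.congr' ?_
    obtain ⟨M, hM⟩ := hK.bddAbove
    filter_upwards [Filter.eventually_gt_atTop M] with r hr
    exact (h0 r fun h => absurd (hM h) (not_le.2 hr)).symm
  have hcont : ContinuousAt F 0 := continuousAt_const.congr hnhds.symm
  rw [integral_Ioi_of_hasDerivAt_of_tendsto hcont.continuousWithinAt hF hG htop, h0 0 h0K, sub_zero]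

theorem hasDerivAt_sinh_pow (n : ℕ) {r : ℝ} (hr : 0 < r) :
    HasDerivAt (fun r => Real.sinh r ^ n) (n * cothR r * Real.sinh r ^ n) r := by
  have hs : Real.sinh r ≠ 0 := (Real.sinh_pos_iff.2 hr).ne'
  refine ((Real.hasDerivAt_sinh r).fun_pow n).congr_deriv ?_
  cases n with
  | zero => simp
  | succ n => simp only [cothR, Nat.add_sub_cancel]; field_simp; ring

theorem continuousOn_cothR : ContinuousOn cothR (Ioi (0 : ℝ)) :=
  Real.continuous_cosh.continuousOn.div Real.continuous_sinh.continuousOn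
    fun _ hr => (Real.sinh_pos_iff.2 hr).ne'

/-- **Multiplier identity, far version** (Lemma 8.3, identity (8.2), radial form). -/
theorem multiplier_identity_far (d : ℕ) (hd : 2 ≤ d)
    (γ : ℝ → ℝ) (hγ : ContDiffOn ℝ (⊤ : ℕ∞) γ (Ioi (0 : ℝ))) (κ : ℝ)
    (v : ℝ → ℂ) (hv : IsTestFun v) :
    - (∫ r in Ioi (0 : ℝ),
        (((rho d ^ 2 + κ ^ 2 : ℝ) : ℂ) * v r + DradC d v r) * (starRingEnd ℂ) (v r)
          * ((γ r * Real.sinh r ^ (d - 1) : ℝ) : ℂ)).re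
      = (∫ r in Ioi (0 : ℝ),
          γ r * (‖deriv v r + (((rho d : ℝ) : ℂ) - Complex.I * (κ : ℂ)) * v r‖ ^ 2
              + 2 * rho d ^ 2 * (cothR r - 1) * ‖v r‖ ^ 2)
            * Real.sinh r ^ (d - 1))
        + 2 * κ * (∫ r in Ioi (0 : ℝ),
            Complex.I * v r
              * (starRingEnd ℂ) (((γ r : ℝ) : ℂ)
                  * (deriv v r + (((rho d : ℝ) : ℂ) - Complex.I * (κ : ℂ)) * v r))
              * ((Real.sinh r ^ (d - 1) : ℝ) : ℂ)).re
        - ∫ r in Ioi (0 : ℝ),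
            ((1 / 2) * deriv (deriv γ) r + rho d * (cothR r - 1) * deriv γ r)
              * ‖v r‖ ^ 2 * Real.sinh r ^ (d - 1) := by
  obtain ⟨hvs, hvc, hv0⟩ := hv
  set K := tsupport v
  have hK : IsCompact K := hvc
  have hvK : ∀ r ∉ K, v r = 0 := fun r hr => image_eq_zero_of_notMem_tsupport hr
  have hdvK : ∀ r ∉ K, deriv v r = 0 := fun r hr =>
    Function.notMem_support.1 fun h => hr (support_deriv_subset h)
  have hv1 : ContDiff ℝ (⊤ : ℕ∞) (deriv v) := (contDiff_infty_iff_deriv.1 hvs).2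
  have hv2 : ContDiff ℝ (⊤ : ℕ∞) (deriv (deriv v)) := (contDiff_infty_iff_deriv.1 hv1).2
  have hγ1 : ContDiffOn ℝ (⊤ : ℕ∞) (deriv γ) (Ioi 0) :=
    ((contDiffOn_infty_iff_deriv_of_isOpen isOpen_Ioi).1 hγ).2
  have hγ2 : ContDiffOn ℝ (⊤ : ℕ∞) (deriv (deriv γ)) (Ioi 0) :=
    ((contDiffOn_infty_iff_deriv_of_isOpen isOpen_Ioi).1 hγ1).2
  have cv := hvs.continuous
  have cv1 := hv1.continuous
  have cv2 := hv2.continuous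
  have cγ := hγ.continuousOn
  have cγ1 := hγ1.continuousOn
  have cγ2 := hγ2.continuousOn
  have cc := continuousOn_cothR
  have hdρ : (d : ℝ) - 1 = 2 * rho d := by unfold rho; ring
  have hdn : ((d - 1 : ℕ) : ℝ) = 2 * rho d := by
    rw [Nat.cast_sub (by omega), Nat.cast_one, hdρ]
  have intL : IntegrableOn (fun r : ℝ =>
      (((rho d ^ 2 + κ ^ 2 : ℝ) : ℂ) * v r + DradC d v r) * (starRingEnd ℂ) (v r)
        * ((γ r * Real.sinh r ^ (d - 1) : ℝ) : ℂ)) (Ioi (0 : ℝ)) := by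
    refine integrableOn_Ioi_of_continuousOn_of_compact hK hv0 ?_ fun r hr => by simp [hvK r hr]
    unfold DradC
    fun_prop
  have intA : IntegrableOn (fun r : ℝ =>
      γ r * (‖deriv v r + (((rho d : ℝ) : ℂ) - Complex.I * (κ : ℂ)) * v r‖ ^ 2
          + 2 * rho d ^ 2 * (cothR r - 1) * ‖v r‖ ^ 2)
        * Real.sinh r ^ (d - 1)) (Ioi (0 : ℝ)) := by
    refine integrableOn_Ioi_of_continuousOn_of_compact hK hv0 ?_
      fun r hr => by simp [hvK r hr, hdvK r hr]
    fun_prop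
  have intB : IntegrableOn (fun r : ℝ =>
      Complex.I * v r * (starRingEnd ℂ) (((γ r : ℝ) : ℂ)
          * (deriv v r + (((rho d : ℝ) : ℂ) - Complex.I * (κ : ℂ)) * v r))
        * ((Real.sinh r ^ (d - 1) : ℝ) : ℂ)) (Ioi (0 : ℝ)) := by
    refine integrableOn_Ioi_of_continuousOn_of_compact hK hv0 ?_ fun r hr => by simp [hvK r hr]
    fun_prop
  have intC : IntegrableOn (fun r : ℝ =>
      ((1 / 2) * deriv (deriv γ) r + rho d * (cothR r - 1) * deriv γ r)
        * ‖v r‖ ^ 2 * Real.sinh r ^ (d - 1)) (Ioi (0 : ℝ)) := by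
    refine integrableOn_Ioi_of_continuousOn_of_compact hK hv0 ?_ fun r hr => by simp [hvK r hr]
    fun_prop
  have eL := Complex.reCLM.integral_comp_comm intL
  have eB := Complex.reCLM.integral_comp_comm intB
  have intL' := Complex.reCLM.integrable_comp intL
  have intB' := Complex.reCLM.integrable_comp intB
  simp only [Complex.reCLM_apply] at eL eB intL' intB'
  rw [← eL, ← eB, ← integral_const_mul, ← sub_eq_zero, ← neg_eq_zero, neg_sub, sub_neg_eq_add,
    ← integral_add intA (intB'.const_mul _), ← integral_sub (intA.fun_add (intB'.const_mul _)) intC,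
    ← integral_add ((intA.fun_add (intB'.const_mul _)).fun_sub intC) intL']
  refine integral_Ioi_eq_zero_of_hasDerivAt_of_compact
    (F := fun r => (γ r * ((deriv v r).re * (v r).re + (deriv v r).im * (v r).im)
      + (rho d * γ r - 1 / 2 * deriv γ r) * ((v r).re * (v r).re + (v r).im * (v r).im))
        * Real.sinh r ^ (d - 1)) hK hv0 ?_
    (((intA.fun_add (intB'.const_mul _)).fun_sub intC).fun_add intL') fun r hr => by simp [hvK r hr]
  intro r hr
  have dv : HasDerivAt v (deriv v r) r := (hvs.differentiable (by simp) r).hasDerivAt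
  have dv1 : HasDerivAt (deriv v) (deriv (deriv v) r) r :=
    (hv1.differentiable (by simp) r).hasDerivAt
  have dγ : HasDerivAt γ (deriv γ r) r :=
    ((hγ.differentiableOn (by simp)).differentiableAt (Ioi_mem_nhds hr)).hasDerivAt
  have dγ1 : HasDerivAt (deriv γ) (deriv (deriv γ) r) r :=
    ((hγ1.differentiableOn (by simp)).differentiableAt (Ioi_mem_nhds hr)).hasDerivAt
  have re_deriv {f : ℝ → ℂ} {f' : ℂ} (h : HasDerivAt f f' r) :
      HasDerivAt (fun x => (f x).re) f'.re r := Complex.reCLM.hasFDerivAt.comp_hasDerivAt r h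
  have im_deriv {f : ℝ → ℂ} {f' : ℂ} (h : HasDerivAt f f' r) :
      HasDerivAt (fun x => (f x).im) f'.im r := Complex.imCLM.hasFDerivAt.comp_hasDerivAt r h
  refine ((((dγ.mul (((re_deriv dv1).mul (re_deriv dv)).add
    ((im_deriv dv1).mul (im_deriv dv)))).add
    (((dγ.const_mul (rho d)).sub (dγ1.const_mul (1 / 2))).mul
      (((re_deriv dv).mul (re_deriv dv)).add ((im_deriv dv).mul (im_deriv dv))))).mul
    (hasDerivAt_sinh_pow (d - 1) hr))).congr_deriv ?_
  simp only [DradC, hdρ, hdn, Complex.sq_norm, Complex.normSq_apply, Pi.add_apply, Pi.mul_apply,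
    Pi.sub_apply, Complex.add_re,
    Complex.add_im, Complex.mul_re, Complex.mul_im, Complex.sub_re, Complex.sub_im,
    Complex.ofReal_re, Complex.ofReal_im, Complex.I_re, Complex.I_im, Complex.conj_re,
    Complex.conj_im]
  ring
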